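/- Every finite cubic graph (simple graph in which every vertex has degree exactly 3) has a (k, σ)-configuration with k = ⌊5σ/2⌋ for every positive integer σ. -/

import Mathlib

/-- A `(k,σ)`-configuration of `G`. -/
def Config {V : Type*} (G : SimpleGraph V) (k σ : ℕ) : Prop :=
  ∃ f : V → Finset (Fin k),
    (∀ v, (f v).card = σ) ∧
    ∀ (i : Fin k) (v : V), i ∈ f v ∨ ∃ u : V, G.Adj v u ∧ i ∈ f u

namespace CubicConfig

/-! ### Two-element labels -/

/-- Codes for the ten two-element subsets of `Fin 5`. -/
abbrev Label := Fin 10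

/-- The bit mask of the two-element subset coded by a label. -/
def mask : Label → ℕ := ![3, 5, 9, 17, 6, 10, 18, 12, 20, 24]

/-- The element `c` belongs to the subset coded by `a`. -/
def Has (a : Label) (c : Fin 5) : Prop := (mask a).testBit c = true

/-- The three subsets cover `Fin 5`. -/
def Cov (a b c : Label) : Prop := mask a ||| mask b ||| mask c = 31

/-- The two subsets are disjoint, i.e. adjacent in the Petersen graph. -/
def Disj (a b : Label) : Prop := mask a &&& mask b = 0

instance (a : Label) (c : Fin 5) : Decidable (Has a c) := inferInstanceAs (Decidable (_ = _))
instance (a b c : Label) : Decidable (Cov a b c) := inferInstanceAs (Decidable (_ = _))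
instance (a b : Label) : Decidable (Disj a b) := inferInstanceAs (Decidable (_ = _))

/-- The subset coded by a label. -/
def toFinset (a : Label) : Finset (Fin 5) := Finset.univ.filter (Has a)

theorem card_toFinset : ∀ a : Label, (toFinset a).card = 2 := by decide +kernel

theorem Cov.has {a b c : Label} (h : Cov a b c) : ∀ x : Fin 5, Has a x ∨ Has b x ∨ Has c x := by
  revert a b c; decide +kernel

theorem Cov.ne_left {a b c : Label} : Cov a b c → a ≠ b := by
  revert a b c; decide +kernel

theorem Cov.ne_outer {a b c : Label} : Cov a b c → a ≠ c := by
  revert a b c; decide +kernel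

theorem cov_of_disj {a b c : Label} : Disj a b → Disj b c → c ≠ a → Cov a b c := by
  revert a b c; decide +kernel

theorem exists_cov_of_ne {a b : Label} : a ≠ b → ∃ c, Cov a b c := by
  revert a b; decide +kernel

theorem exists_first_step (t F : Label) : ∃ c, Disj t c ∧ ¬ (Disj c F ∧ F ≠ t) := by
  revert t F; decide +kernel

theorem exists_step {a b : Label} (F : Label) :
    Disj a b → ∃ c, Disj b c ∧ c ≠ a ∧ ¬ (Disj c F ∧ F ≠ b) := by
  revert a b F; decide +kernel

theorem exists_meeting_first (t F t' : Label) :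
    ∃ c, Disj t c ∧ ∃ d, Disj c d ∧ d ≠ t ∧ d ≠ F ∧ ¬ Disj d t' := by
  revert t F t'; decide +kernel

theorem exists_meeting {a b : Label} (F t' : Label) (h : Disj a b) :
    ∃ c, Disj b c ∧ c ≠ a ∧ ∃ d, Disj c d ∧ d ≠ b ∧ d ≠ F ∧ ¬ Disj d t' := by
  revert t' F; revert a b; decide +kernel

theorem exists_meeting_neighbor {t t' : Label} : t ≠ t' → ∃ c, Disj t c ∧ ¬ Disj c t' := by
  revert t t'; decide +kernel

theorem exists_closed_ear (t F : Label) :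
    ∃ b c d, Cov t b c ∧ c ≠ F ∧ Cov b c d ∧ Cov c d t := by
  revert t F; decide +kernel

/-- Three ways to complete the labels `a`, `b` by two labels `c`, `d` before `t'`, with distinct
values of `c` and distinct values of `d`. -/
theorem exists_three_completions : ∀ a b : Label, Disj a b → ∀ t', ¬ Disj b t' →
    ∃ c₁, Cov a b c₁ ∧ ∃ d₁, Cov b c₁ d₁ ∧ Cov c₁ d₁ t' ∧
    ∃ c₂, c₁ < c₂ ∧ Cov a b c₂ ∧ ∃ d₂, d₁ ≠ d₂ ∧ Cov b c₂ d₂ ∧ Cov c₂ d₂ t' ∧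
    ∃ c₃, c₂ < c₃ ∧ Cov a b c₃ ∧ ∃ d₃, d₁ ≠ d₃ ∧ d₂ ≠ d₃ ∧ Cov b c₃ d₃ ∧ Cov c₃ d₃ t' := by
  decide +kernel

theorem exists_final_steps {a b t' : Label} (F F' : Label) (hab : Disj a b) (hbt : ¬ Disj b t') :
    ∃ c, Cov a b c ∧ c ≠ F ∧ ∃ d, d ≠ F' ∧ Cov b c d ∧ Cov c d t' := by
  obtain ⟨c₁, h₁, d₁, p₁, q₁, c₂, h₁₂, h₂, d₂, k₁₂, p₂, q₂, c₃, h₂₃, h₃, d₃, k₁₃, k₂₃, p₃,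
    q₃⟩ := exists_three_completions a b hab t' hbt
  by_cases e₁ : c₁ ≠ F ∧ d₁ ≠ F'
  · exact ⟨c₁, h₁, e₁.1, d₁, e₁.2, p₁, q₁⟩
  by_cases e₂ : c₂ ≠ F ∧ d₂ ≠ F'
  · exact ⟨c₂, h₂, e₂.1, d₂, e₂.2, p₂, q₂⟩
  exact ⟨c₃, h₃, by grind, d₃, by grind, p₃, q₃⟩

/-! ### Labelling an ear -/

/-- The first `n` triples of consecutive labels cover `Fin 5`, and the labels avoid `φ`. -/
def Good (φ : ℕ → (ℕ → Label) → Label) (p : ℕ → Label) (n : ℕ) : Prop :=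
  ∀ i < n, Cov (p i) (p (i + 1)) (p (i + 2)) ∧ p (i + 2) ≠ φ (i + 2) p

/-- The value of `φ j` only depends on the labels with index at most `j - 2`. -/
def Causal (φ : ℕ → (ℕ → Label) → Label) : Prop :=
  ∀ j p q, (∀ i, i + 2 ≤ j → p i = q i) → φ j p = φ j q

section
variable {φ : ℕ → (ℕ → Label) → Label}

theorem Causal.update (hφ : Causal φ) {j k : ℕ} (h : j < k + 2) (p : ℕ → Label) (c : Label) :
    φ j (Function.update p k c) = φ j p :=
  hφ _ _ _ fun i hi => Function.update_of_ne (by omega) _ _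

theorem Good.update (hφ : Causal φ) {p : ℕ → Label} {n : ℕ} (hp : Good φ p n) {c : Label}
    (hc : Cov (p n) (p (n + 1)) c) (hne : c ≠ φ (n + 2) p) :
    Good φ (Function.update p (n + 2) c) (n + 1) := by
  intro i hi
  rw [hφ.update (by omega)]
  rcases Nat.lt_succ_iff_lt_or_eq.mp hi with h | rfl
  · have h0 : i ≠ n + 2 := by omega
    have h1 : i + 1 ≠ n + 2 := by omega
    have h2 : i + 2 ≠ n + 2 := by omega
    simpa [Function.update_of_ne, h0, h1, h2, -Nat.add_right_cancel_iff] using hp i h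
  · simpa [Function.update_of_ne] using ⟨hc, hne⟩

theorem exists_good_walk (hφ : Causal φ) (t : Label) (j : ℕ) :
    ∃ p : ℕ → Label, p 0 = t ∧ Disj (p j) (p (j + 1)) ∧ Good φ p j ∧
      ¬ (Disj (p (j + 1)) (φ (j + 2) p) ∧ φ (j + 2) p ≠ p j) := by
  induction j with
  | zero =>
    obtain ⟨c, hc, hF⟩ := exists_first_step t (φ 2 fun _ => t)
    refine ⟨Function.update (fun _ => t) 1 c, by simp, by simpa using hc,
      fun i hi => absurd hi (by omega), ?_⟩
    rw [hφ.update (by omega)]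
    simpa using hF
  | succ j ih =>
    obtain ⟨p, hp0, hd, hg, hF⟩ := ih
    obtain ⟨c, hbc, hca, hF'⟩ := exists_step (φ (j + 3) p) hd
    have hne : c ≠ φ (j + 2) p := by
      rintro rfl
      exact hF ⟨hbc, hca⟩
    refine ⟨Function.update p (j + 2) c, by simpa [Function.update_of_ne] using hp0,
      by simpa [Function.update_of_ne] using hbc, hg.update hφ (cov_of_disj hd hbc hca) hne, ?_⟩
    rw [hφ.update (by omega)]
    simpa [Function.update_of_ne] using hF'

theorem exists_good_walk_meeting (hφ : Causal φ) (t t' : Label) (n : ℕ) (h : n = 0 → t ≠ t') :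
    ∃ p : ℕ → Label, p 0 = t ∧ Disj (p n) (p (n + 1)) ∧ ¬ Disj (p (n + 1)) t' ∧ Good φ p n := by
  match n with
  | 0 =>
    obtain ⟨c, hc, hc'⟩ := exists_meeting_neighbor (h rfl)
    exact ⟨Function.update (fun _ => t) 1 c, by simp, by simpa using hc, by simpa using hc',
      fun i hi => absurd hi (by omega)⟩
  | 1 =>
    obtain ⟨c, hc, d, hd, hdt, hdF, hdt'⟩ := exists_meeting_first t (φ 2 fun _ => t) t'
    have hg : Good φ (Function.update (fun _ => t) 1 c) 0 := fun i hi => absurd hi (by omega)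
    refine ⟨Function.update (Function.update (fun _ => t) 1 c) 2 d, by simp,
      by simpa [Function.update_of_ne] using hd, by simpa using hdt', hg.update hφ ?_ ?_⟩
    · simpa using cov_of_disj hc hd hdt
    · rwa [hφ.update (by omega)]
  | k + 2 =>
    obtain ⟨p, hp0, hd, hg, hF⟩ := exists_good_walk hφ t k
    obtain ⟨c, hbc, hca, d, hcd, hdb, hdF, hdt'⟩ := exists_meeting (φ (k + 3) p) t' hd
    have hne : c ≠ φ (k + 2) p := by
      rintro rfl
      exact hF ⟨hbc, hca⟩
    have hg' := hg.update hφ (cov_of_disj hd hbc hca) hne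
    refine ⟨Function.update (Function.update p (k + 2) c) (k + 3) d,
      by simpa [Function.update_of_ne] using hp0,
      by simpa [Function.update_of_ne] using hcd, by simpa using hdt', hg'.update hφ ?_ ?_⟩
    · simpa [Function.update_of_ne] using cov_of_disj hbc hcd hdb
    · rwa [hφ.update (by omega)]

theorem exists_ear_labelling (hφ : Causal φ) (t t' : Label) {m : ℕ} (hm : 3 ≤ m) :
    ∃ p : ℕ → Label, p 0 = t ∧ p (m + 1) = t' ∧
      (∀ i < m, Cov (p i) (p (i + 1)) (p (i + 2))) ∧
      ∀ j, 2 ≤ j → j ≤ m → (j < m ∨ 3 < m) → p j ≠ φ j p := by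
  obtain ⟨n, rfl⟩ := Nat.exists_eq_add_of_le' hm
  by_cases h : n = 0 ∧ t = t'
  · obtain ⟨rfl, rfl⟩ := h
    obtain ⟨b, c, d, h1, hF, h2, h3⟩ := exists_closed_ear t (φ 2 fun _ => t)
    refine ⟨fun i => if i = 1 then b else if i = 2 then c else if i = 3 then d else t,
      by simp, by simp, ?_, ?_⟩
    · intro i hi
      interval_cases i <;> simpa
    · intro j hj hj' hj''
      obtain rfl : j = 2 := by omega
      simp only [OfNat.ofNat_ne_one, ↓reduceIte]
      convert hF using 1
      refine hφ _ _ _ fun i hi => ?_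
      obtain rfl : i = 0 := by omega
      simp
  · obtain ⟨p, hp0, hd, hdt, hg⟩ := exists_good_walk_meeting hφ t t' n (by tauto)
    obtain ⟨c, hc, hcF, d, hdF, hbcd, hcdt⟩ :=
      exists_final_steps (φ (n + 2) p) (φ (n + 3) p) hd hdt
    have hg' := hg.update hφ hc hcF
    have hg'' := hg'.update hφ (c := d) (by simpa [Function.update_of_ne] using hbcd)
      (by rwa [hφ.update (by omega)])
    refine ⟨Function.update (Function.update (Function.update p (n + 2) c) (n + 3) d) (n + 4) t',
      by simpa [Function.update_of_ne] using hp0, by simp, fun i hi => ?_, fun j hj hj' _ => ?_⟩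
    · rcases Nat.lt_succ_iff_lt_or_eq.mp hi with h | rfl
      · have h0 : i ≠ n + 4 := by omega
        have h1 : i + 1 ≠ n + 4 := by omega
        have h2 : i + 2 ≠ n + 4 := by omega
        rw [Function.update_of_ne h0, Function.update_of_ne h1, Function.update_of_ne h2]
        exact (hg'' i h).1
      · simpa [Function.update_of_ne] using hcdt
    · obtain ⟨i, rfl⟩ := Nat.exists_eq_add_of_le' hj
      rw [hφ.update (by omega), Function.update_of_ne (by omega)]
      exact (hg'' i (by omega)).2

end

/-! ### Labelling a cycle -/

/-- There is a sequence of labels of length `n` with covering consecutive triples which can be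
concatenated with itself and with any other such sequence. -/
def HasBlock (n : ℕ) : Prop :=
  ∃ q : ℕ → Label, q 0 = 0 ∧ q 1 = 7 ∧ q n = 0 ∧ q (n + 1) = 7 ∧
    ∀ i < n, Cov (q i) (q (i + 1)) (q (i + 2))

theorem hasBlock_three : HasBlock 3 :=
  ⟨fun i => ![0, 7, 3, 0, 7] (Fin.ofNat 5 i), by decide +kernel⟩

theorem hasBlock_five : HasBlock 5 :=
  ⟨fun i => ![0, 7, 3, 4, 9, 0, 7] (Fin.ofNat 7 i), by decide +kernel⟩

theorem HasBlock.add {a b : ℕ} (ha : HasBlock a) (hb : HasBlock b) (h : 2 ≤ a) :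
    HasBlock (a + b) := by
  obtain ⟨q, h0, h1, h2, h3, hq⟩ := ha
  obtain ⟨r, k0, k1, k2, k3, hr⟩ := hb
  have key : ∀ i, i ≤ a + 1 → (if i < a then q i else r (i - a)) = q i := by
    intro i hi
    split_ifs with h'
    · rfl
    · obtain rfl | rfl : i = a ∨ i = a + 1 := by omega
      · simp [h2, k0]
      · simp [h3, k1]
  refine ⟨fun i => if i < a then q i else r (i - a), ?_, ?_, ?_, ?_, fun i hi => ?_⟩ <;> dsimp only
  · rw [key _ (by omega), h0]
  · rw [key _ (by omega), h1]
  · simpa using k2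
  · simpa [add_assoc] using k3
  · rcases lt_or_ge i a with h' | h'
    · rw [key _ (by omega), key _ (by omega), key _ (by omega)]
      exact hq i h'
    · obtain ⟨j, rfl⟩ := Nat.exists_eq_add_of_le h'
      simpa [add_assoc] using hr j (by omega)

theorem hasBlock {n : ℕ} (h3 : 3 ≤ n) (h4 : n ≠ 4) (h7 : n ≠ 7) : HasBlock n := by
  induction n using Nat.strong_induction_on with
  | _ n ih =>
    by_cases e3 : n = 3
    · exact e3 ▸ hasBlock_three
    by_cases e5 : n = 5
    · exact e5 ▸ hasBlock_five
    by_cases e10 : n = 10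
    · exact e10 ▸ hasBlock_five.add hasBlock_five (by omega)
    obtain ⟨k, rfl⟩ := Nat.exists_eq_add_of_le h3
    exact hasBlock_three.add (ih k (by omega) (by omega) (by omega) (by omega)) (by omega)

theorem exists_cycle_labelling {n : ℕ} (h3 : 3 ≤ n) (h4 : n ≠ 4) (h7 : n ≠ 7) :
    ∃ p : ℕ → Label, (∀ i, p (i + n) = p i) ∧ (∀ i, Cov (p i) (p (i + 1)) (p (i + 2))) ∧
      (n = 10 → ∀ i, p i ≠ p (i + 5)) := by
  by_cases h10 : n = 10
  · subst h10
    let w : Fin 10 → Label := ![0, 1, 9, 4, 0, 9, 7, 0, 8, 9]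
    have hw : ∀ i, Cov (w i) (w (i + 1)) (w (i + 2)) ∧ w i ≠ w (i + 5) := by decide +kernel
    have hadd : ∀ i j : ℕ, Fin.ofNat 10 (i + j) = Fin.ofNat 10 i + Fin.ofNat 10 j := by
      intro i j
      ext
      simp [Fin.val_add]
    refine ⟨fun i => w (Fin.ofNat 10 i), fun i => ?_, fun i => ?_, fun _ i => ?_⟩ <;>
      dsimp only <;> simp only [hadd]
    · congr 1
      exact add_zero _
    · exact (hw _).1
    · exact (hw _).2
  · obtain ⟨q, h0, h1, h2, h3', hq⟩ := hasBlock h3 h4 h7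
    refine ⟨fun i => q (i % n), fun i => by simp, fun i => ?_, fun h => absurd h h10⟩
    have key : ∀ j, j ≤ n + 1 → q (j % n) = q j := by
      intro j hj
      rcases lt_or_ge j n with h | h
      · rw [Nat.mod_eq_of_lt h]
      · obtain rfl | rfl : j = n ∨ j = n + 1 := by omega
        · simp [h0, h2]
        · rw [Nat.add_mod_left, Nat.mod_eq_of_lt (by omega), h1, h3']
    have hlt : i % n < n := Nat.mod_lt _ (by omega)
    dsimp only
    rw [← Nat.mod_add_mod i n 1, ← Nat.mod_add_mod i n 2, key (i % n + 1) (by omega),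
      key (i % n + 2) (by omega)]
    exact hq _ hlt

/-! ### Partial configurations -/

section
variable {V : Type*} {G : SimpleGraph V} {S : Finset V} {f : V → Label}

/-- A partial configuration: the vertices of `S` are labelled by `f` so that the closed
neighbourhood inside `S` of every vertex of `S` covers `Fin 5`, and every vertex outside `S` with
several neighbours in `S` has two with distinct labels. -/
structure IsPartial (G : SimpleGraph V) (S : Finset V) (f : V → Label) : Prop where
  cover : ∀ v ∈ S, ∀ c, ∃ u ∈ S, (u = v ∨ G.Adj v u) ∧ Has (f u) c
  sep : ∀ v ∉ S, ∀ x ∈ S, ∀ y ∈ S, G.Adj v x → G.Adj v y → x ≠ y →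
    ∃ x' ∈ S, ∃ y' ∈ S, G.Adj v x' ∧ G.Adj v y' ∧ f x' ≠ f y'

theorem IsPartial.union [DecidableEq V] (hP : IsPartial G S f) {C : Finset V} {f' : V → Label}
    (hf : ∀ x ∈ S, f' x = f x)
    (hC : ∀ v ∈ C, ∀ c, ∃ u ∈ S ∪ C, (u = v ∨ G.Adj v u) ∧ Has (f' u) c)
    (hSC : ∀ v ∉ S ∪ C, ∀ u ∈ S, ∀ x ∈ C, G.Adj v u → G.Adj v x →
      ∃ x' ∈ S ∪ C, ∃ y' ∈ S ∪ C, G.Adj v x' ∧ G.Adj v y' ∧ f' x' ≠ f' y')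
    (hCC : ∀ v ∉ S ∪ C, (∀ u ∈ S, ¬ G.Adj v u) → ∀ x ∈ C, ∀ y ∈ C, G.Adj v x → G.Adj v y →
      x ≠ y → ∃ x' ∈ S ∪ C, ∃ y' ∈ S ∪ C, G.Adj v x' ∧ G.Adj v y' ∧ f' x' ≠ f' y') :
    IsPartial G (S ∪ C) f' := by
  refine ⟨fun v hv c => ?_, fun v hv x hx y hy hvx hvy hxy => ?_⟩
  · rcases Finset.mem_union.mp hv with h | h
    · obtain ⟨u, hu, hu', hc⟩ := hP.cover v h c
      exact ⟨u, Finset.mem_union_left _ hu, hu', hf u hu ▸ hc⟩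
    · exact hC v h c
  · rcases Finset.mem_union.mp hx with hxS | hxC <;> rcases Finset.mem_union.mp hy with hyS | hyC
    · obtain ⟨x', hx', y', hy', h1, h2, h3⟩ := hP.sep v
        (fun h => hv (Finset.mem_union_left _ h)) x hxS y hyS hvx hvy hxy
      exact ⟨x', Finset.mem_union_left _ hx', y', Finset.mem_union_left _ hy', h1, h2,
        by rwa [hf x' hx', hf y' hy']⟩
    · exact hSC v hv x hxS y hyC hvx hvy
    · exact hSC v hv y hyS x hxC hvy hvx
    · by_cases h : ∃ u ∈ S, G.Adj v u
      · obtain ⟨u, hu, hvu⟩ := h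
        exact hSC v hv u hu x hxC hvu hvx
      · exact hCC v hv (fun u hu hvu => h ⟨u, hu, hvu⟩) x hxC y hyC hvx hvy hxy

/-- No partial configuration labels more vertices than `S`. -/
def IsLargest (G : SimpleGraph V) (S : Finset V) : Prop :=
  ∀ S' f', IsPartial G S' f' → S'.card ≤ S.card

theorem IsLargest.not_isPartial_union [DecidableEq V] (hS : IsLargest G S) {C : Finset V} {v : V}
    (hv : v ∈ C) (hvS : v ∉ S) (f' : V → Label) : ¬ IsPartial G (S ∪ C) f' := fun h =>
  (hS _ _ h).not_gt <| Finset.card_lt_card <| Finset.ssubset_iff_subset_ne.mpr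
    ⟨Finset.subset_union_left, fun h' => hvS (h' ▸ Finset.mem_union_right _ hv)⟩

/-! ### Paths avoiding a set of vertices -/

/-- The first `k` terms of `e` form a path in `G` avoiding `S`. -/
structure IsPathOff (G : SimpleGraph V) (S : Finset V) (k : ℕ) (e : ℕ → V) : Prop where
  adj : ∀ i, i + 1 < k → G.Adj (e i) (e (i + 1))
  notMem : ∀ i < k, e i ∉ S
  inj : ∀ i < k, ∀ j < k, e i = e j → i = j

variable {k l : ℕ} {e : ℕ → V}

namespace IsPathOff

theorem le_card [Fintype V] (h : IsPathOff G S k e) : k ≤ Fintype.card V := by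
  classical
  have := Finset.card_le_univ ((Finset.range k).image e)
  rwa [Finset.card_image_of_injOn, Finset.card_range] at this
  intro i hi j hj
  exact h.inj i (by simpa using hi) j (by simpa using hj)

theorem take (h : IsPathOff G S k e) (hl : l ≤ k) : IsPathOff G S l e :=
  ⟨fun i hi => h.adj i (by omega), fun i hi => h.notMem i (by omega),
    fun i hi j hj => h.inj i (by omega) j (by omega)⟩

theorem drop (h : IsPathOff G S k e) (l : ℕ) : IsPathOff G S (k - l) fun i => e (l + i) :=
  ⟨fun i hi => h.adj (l + i) (by omega), fun i hi => h.notMem (l + i) (by omega),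
    fun i hi j hj hij => by have := h.inj (l + i) (by omega) (l + j) (by omega) hij; omega⟩

theorem reverse (h : IsPathOff G S k e) : IsPathOff G S k fun i => e (k - 1 - i) := by
  refine ⟨fun i hi => ?_, fun i hi => h.notMem _ (by omega), fun i hi j hj hij => ?_⟩
  · have := (h.adj (k - 1 - (i + 1)) (by omega)).symm
    rwa [show k - 1 - (i + 1) + 1 = k - 1 - i by omega] at this
  · have := h.inj _ (by omega) _ (by omega) hij
    omega

theorem snoc (h : IsPathOff G S k e) {v : V} (hv : v ∉ S) (hne : ∀ i < k, e i ≠ v)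
    (hadj : G.Adj (e (k - 1)) v) : IsPathOff G S (k + 1) fun i => if i < k then e i else v := by
  refine ⟨fun i hi => ?_, fun i hi => ?_, fun i hi j hj hij => ?_⟩
  · have hik : i < k := by omega
    simp only [hik, if_true]
    split_ifs with h'
    · exact h.adj i h'
    · rwa [show i = k - 1 by omega]
  · split_ifs with h'
    · exact h.notMem i h'
    · exact hv
  · split_ifs at hij with h1 h2 h2
    · exact h.inj i h1 j h2 hij
    · exact absurd hij (hne i h1)
    · exact absurd hij.symm (hne j h2)
    · omega

end IsPathOff

/-- A path avoiding `S` whose two end vertices have a neighbour in `S`. -/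
structure IsAttached (G : SimpleGraph V) (S : Finset V) (k : ℕ) (e : ℕ → V) : Prop
    extends IsPathOff G S k e where
  first : ∃ u ∈ S, G.Adj (e 0) u
  last : ∃ u ∈ S, G.Adj (e (k - 1)) u

theorem IsAttached.reverse (h : IsAttached G S k e) : IsAttached G S k fun i => e (k - 1 - i) :=
  ⟨h.toIsPathOff.reverse, by simpa using h.last, by simpa using h.first⟩

theorem IsAttached.snoc (h : IsAttached G S k e) (hk : 0 < k) {v u : V} (hv : v ∉ S)
    (hne : ∀ i < k, e i ≠ v) (hadj : G.Adj (e (k - 1)) v) (hu : u ∈ S) (hvu : G.Adj v u) :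
    IsAttached G S (k + 1) fun i => if i < k then e i else v :=
  ⟨h.toIsPathOff.snoc hv hne hadj, by simpa [hk] using h.first, u, hu, by simpa using hvu⟩

/-! ### Cubic graphs -/

/-- Every vertex has exactly three neighbours. -/
def IsCubic (G : SimpleGraph V) : Prop :=
  ∀ v, ∃ a b c, a ≠ b ∧ a ≠ c ∧ b ≠ c ∧ ∀ w, G.Adj v w ↔ w = a ∨ w = b ∨ w = c

theorem isCubic_of_degree [Fintype V] [DecidableEq V] [DecidableRel G.Adj]
    (h : ∀ v, G.degree v = 3) : IsCubic G := by
  intro v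
  obtain ⟨a, b, c, hab, hac, hbc, hN⟩ := Finset.card_eq_three.mp (h v)
  refine ⟨a, b, c, hab, hac, hbc, fun w => ?_⟩
  rw [← G.mem_neighborFinset, hN]
  simp

theorem IsCubic.eq_of_adj (hG : IsCubic G) {v a b x y : V} (ha : G.Adj v a) (hb : G.Adj v b)
    (hx : G.Adj v x) (hy : G.Adj v y) (hab : a ≠ b) (hxa : x ≠ a) (hxb : x ≠ b) (hya : y ≠ a)
    (hyb : y ≠ b) : x = y := by
  obtain ⟨p, q, r, -, -, -, h⟩ := hG v
  rw [h] at ha hb hx hy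
  grind

theorem IsCubic.exists_adj_ne (hG : IsCubic G) (v a : V) :
    ∃ x y, G.Adj v x ∧ G.Adj v y ∧ x ≠ y ∧ x ≠ a ∧ y ≠ a := by
  obtain ⟨p, q, r, h1, h2, h3, h⟩ := hG v
  have hp : G.Adj v p := by simp [h]
  have hq : G.Adj v q := by simp [h]
  have hr : G.Adj v r := by simp [h]
  by_cases hpa : p = a
  · exact ⟨q, r, hq, hr, h3, by grind, by grind⟩
  · by_cases hqa : q = a
    · exact ⟨p, r, hp, hr, h2, by grind, by grind⟩
    · exact ⟨p, q, hp, hq, h1, by grind, by grind⟩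

theorem exists_isGreatest_nat {P : ℕ → Prop} {a N : ℕ} (h : P a) (hN : ∀ k, P k → k ≤ N) :
    ∃ k, P k ∧ ∀ l, P l → l ≤ k :=
  ⟨sSup {k | P k}, Nat.sSup_mem ⟨a, h⟩ ⟨N, hN⟩, fun _ hl => le_csSup ⟨N, hN⟩ hl⟩

end

/-! ### Adding an ear -/

section
variable {V : Type*} {G : SimpleGraph V} {S : Finset V} {f : V → Label} {k : ℕ} {e : ℕ → V}

/-- The label which the vertex `w = e i` of an ear should avoid for the sake of its only neighbour
outside `T`; here `p (j + 1)` is the label of `e j`. -/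
theorem exists_avoid (G : SimpleGraph V) (S T : Finset V) (f : V → Label) (e : ℕ → V) (i : ℕ)
    {w : V} (huniq : ∀ v v', v ∉ T → v' ∉ T → G.Adj v w → G.Adj v' w → v = v') :
    ∃ ψ : (ℕ → Label) → Label, (∀ p q, (∀ j, j + 2 ≤ i + 1 → p j = q j) → ψ p = ψ q) ∧
      (∀ v ∉ T, G.Adj v w → (∃ u ∈ S, G.Adj v u) → ∃ u ∈ S, G.Adj v u ∧ ∀ p, ψ p = f u) ∧
      (∀ v ∉ T, G.Adj v w → (∀ u ∈ S, ¬ G.Adj v u) → (∃ j, j + 3 ≤ i ∧ G.Adj v (e j)) →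
        ∃ j, j + 3 ≤ i ∧ G.Adj v (e j) ∧ ∀ p, ψ p = p (j + 1)) := by
  by_cases h1 : ∃ v ∉ T, G.Adj v w ∧ ∃ u ∈ S, G.Adj v u
  · obtain ⟨v, hv, hvw, u, hu, hvu⟩ := h1
    refine ⟨fun _ => f u, fun _ _ _ => rfl, fun v' hv' hvw' _ => ?_, fun v' hv' hvw' h _ => ?_⟩
    · obtain rfl := huniq v v' hv hv' hvw hvw'
      exact ⟨u, hu, hvu, fun _ => rfl⟩
    · obtain rfl := huniq v v' hv hv' hvw hvw'
      exact absurd hvu (h u hu)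
  by_cases h2 : ∃ v ∉ T, G.Adj v w ∧ ∃ j, j + 3 ≤ i ∧ G.Adj v (e j)
  · obtain ⟨v, hv, hvw, j, hj, hvj⟩ := h2
    refine ⟨fun p => p (j + 1), fun p q h => h _ (by omega),
      fun v' hv' hvw' h => absurd ⟨v', hv', hvw', h⟩ h1, fun v' hv' hvw' _ _ => ?_⟩
    obtain rfl := huniq v v' hv hv' hvw hvw'
    exact ⟨j, hj, hvj, fun _ => rfl⟩
  · exact ⟨fun _ => 0, fun _ _ _ => rfl, fun v' hv' hvw' h => absurd ⟨v', hv', hvw', h⟩ h1,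
      fun v' hv' hvw' _ h => absurd ⟨v', hv', hvw', h⟩ h2⟩

/-- Any vertex of an ear has at most one neighbour off the ear. -/
theorem IsAttached.outer_unique (hG : IsCubic G) (he : IsAttached G S k e) (hk : 2 ≤ k)
    {T : Finset V} (hST : S ⊆ T) (heT : ∀ i < k, e i ∈ T) {i : ℕ} (hi : i < k) {v v' : V}
    (hv : v ∉ T) (hv' : v' ∉ T) (h : G.Adj v (e i)) (h' : G.Adj v' (e i)) : v = v' := by
  obtain ⟨a, b, ha, hb, hab, haT, hbT⟩ :
      ∃ a b, G.Adj (e i) a ∧ G.Adj (e i) b ∧ a ≠ b ∧ a ∈ T ∧ b ∈ T := by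
    obtain ⟨u, hu, hadj⟩ := he.first
    obtain ⟨u', hu', hadj'⟩ := he.last
    rcases Nat.eq_zero_or_pos i with rfl | h0
    · refine ⟨u, e 1, hadj, he.adj 0 (by omega), ?_, hST hu, heT 1 (by omega)⟩
      rintro rfl
      exact he.notMem 1 (by omega) hu
    · obtain ⟨j, rfl⟩ := Nat.exists_eq_add_of_le' h0
      have hj : G.Adj (e (j + 1)) (e j) := (he.adj j hi).symm
      by_cases hlast : j + 1 = k - 1
      · refine ⟨e j, u', hj, hlast ▸ hadj', ?_, heT j (by omega), hST hu'⟩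
        rintro rfl
        exact he.notMem j (by omega) hu'
      · refine ⟨e j, e (j + 2), hj, he.adj (j + 1) (by omega), fun h => ?_, heT j (by omega),
          heT _ (by omega)⟩
        have := he.inj _ (by omega) _ (by omega) h
        omega
  exact hG.eq_of_adj ha hb h.symm h'.symm hab (fun h => hv (h ▸ haT)) (fun h => hv (h ▸ hbT))
    (fun h => hv' (h ▸ haT)) (fun h => hv' (h ▸ hbT))

theorem IsPartial.not_isLargest_of_longest_isAttached (hG : IsCubic G) (hP : IsPartial G S f)
    (hk : 3 ≤ k) (he : IsAttached G S k e) (hmax : ∀ l e', IsAttached G S l e' → l ≤ k) :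
    ¬ IsLargest G S := by
  classical
  intro hS
  obtain ⟨s, hs, hs'⟩ := he.first
  obtain ⟨t, ht, ht'⟩ := he.last
  set C := (Finset.range k).image e with hC
  have heC : ∀ i < k, e i ∈ C := fun i hi => Finset.mem_image_of_mem e (Finset.mem_range.mpr hi)
  have heT : ∀ i < k, e i ∈ S ∪ C := fun i hi => Finset.mem_union_right _ (heC i hi)
  have hmemC : ∀ x ∈ C, ∃ i < k, e i = x := fun x hx => by simpa [hC] using hx
  have hψ : ∀ i, ∃ ψ : (ℕ → Label) → Label,
      (∀ p q, (∀ j, j + 2 ≤ i + 1 → p j = q j) → ψ p = ψ q) ∧ (i < k →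
      (∀ v ∉ S ∪ C, G.Adj v (e i) → (∃ u ∈ S, G.Adj v u) →
        ∃ u ∈ S, G.Adj v u ∧ ∀ p, ψ p = f u) ∧
      (∀ v ∉ S ∪ C, G.Adj v (e i) → (∀ u ∈ S, ¬ G.Adj v u) →
        (∃ j, j + 3 ≤ i ∧ G.Adj v (e j)) →
        ∃ j, j + 3 ≤ i ∧ G.Adj v (e j) ∧ ∀ p, ψ p = p (j + 1))) := by
    intro i
    by_cases hi : i < k
    · obtain ⟨ψ, h1, h2⟩ := exists_avoid G S (S ∪ C) f e i (w := e i) fun v v' hv hv' h h' =>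
        he.outer_unique hG (by omega) Finset.subset_union_left heT hi hv hv' h h'
      exact ⟨ψ, h1, fun _ => h2⟩
    · exact ⟨fun _ => 0, fun _ _ _ => rfl, fun h => absurd h hi⟩
  choose ψ hψ hψ' using hψ
  have hφ : Causal fun j => ψ (j - 1) := fun j p q h => hψ _ p q fun i hi =>
    h i (by omega)
  obtain ⟨p, hp0, hpk, hcov, hav⟩ := exists_ear_labelling hφ (f s) (f t) hk
  have hinj : Set.InjOn e (Set.Iio k) := fun i hi j hj h => he.inj i hi j hj h
  set f' : V → Label := fun x =>
    if x ∈ S then f x else p (Function.invFunOn e (Set.Iio k) x + 1) with hf'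
  have hfS : ∀ x ∈ S, f' x = f x := fun x hx => if_pos hx
  have hfe : ∀ i < k, f' (e i) = p (i + 1) := fun i hi => by
    rw [hf']
    dsimp only
    rw [if_neg (he.notMem i hi), hinj.leftInvOn_invFunOn (Set.mem_Iio.mpr hi)]
  refine hS.not_isPartial_union (heC 0 (by omega)) (he.notMem 0 (by omega)) f'
    (hP.union hfS ?_ ?_ ?_)
  · intro v hv c
    obtain ⟨i, hi, rfl⟩ := hmemC v hv
    obtain ⟨x, hx, hix, hfx⟩ : ∃ x ∈ S ∪ C, G.Adj (e i) x ∧ f' x = p i := by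
      rcases Nat.eq_zero_or_pos i with rfl | h0
      · exact ⟨s, Finset.mem_union_left _ hs, hs', by rw [hfS s hs, hp0]⟩
      · obtain ⟨j, rfl⟩ := Nat.exists_eq_add_of_le' h0
        exact ⟨e j, heT j (by omega), (he.adj j hi).symm, hfe j (by omega)⟩
    obtain ⟨y, hy, hiy, hfy⟩ : ∃ y ∈ S ∪ C, G.Adj (e i) y ∧ f' y = p (i + 2) := by
      by_cases hlast : i = k - 1
      · exact ⟨t, Finset.mem_union_left _ ht, hlast ▸ ht', by
          rw [hfS t ht, ← hpk, hlast, show k - 1 + 2 = k + 1 by omega]⟩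
      · exact ⟨e (i + 1), heT _ (by omega), he.adj i (by omega), hfe _ (by omega)⟩
    rcases (hcov i hi).has c with h | h | h
    · exact ⟨x, hx, Or.inr hix, hfx ▸ h⟩
    · exact ⟨e i, heT i hi, Or.inl rfl, hfe i hi ▸ h⟩
    · exact ⟨y, hy, Or.inr hiy, hfy ▸ h⟩
  · intro v hv u hu x hx hvu hvx
    obtain ⟨i, hi, rfl⟩ := hmemC x hx
    have hvS : v ∉ S := fun h => hv (Finset.mem_union_left _ h)
    have hve : ∀ j < k, e j ≠ v := fun j hj h => hv (h ▸ heT j hj)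
    have hlast : i ≠ k - 1 := by
      rintro rfl
      have := hmax _ _ (he.snoc (by omega) hvS hve hvx.symm hu hvu)
      omega
    have hfirst : i ≠ 0 := by
      rintro rfl
      have := hmax _ _ (he.reverse.snoc (by omega) hvS (fun j hj => hve _ (by omega))
        (by simpa using hvx.symm) hu hvu)
      omega
    obtain ⟨u', hu', hvu', hψu⟩ := (hψ' i hi).1 v hv hvx ⟨u, hu, hvu⟩
    refine ⟨e i, heT i hi, u', Finset.mem_union_left _ hu', hvx, hvu', ?_⟩
    rw [hfe i hi, hfS u' hu', ← hψu p]
    exact hav (i + 1) (by omega) (by omega) (by omega)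
  · intro v hv hvS x hx y hy hvx hvy hxy
    have key : ∀ i j, i < j → j < k → G.Adj v (e i) → G.Adj v (e j) →
        ∃ x' ∈ S ∪ C, ∃ y' ∈ S ∪ C, G.Adj v x' ∧ G.Adj v y' ∧ f' x' ≠ f' y' := by
      intro i j hij hj hvi hvj
      by_cases h3 : i + 3 ≤ j
      · obtain ⟨l, hl, hvl, hψl⟩ := (hψ' j hj).2 v hv hvj hvS ⟨i, h3, hvi⟩
        refine ⟨e j, heT j hj, e l, heT l (by omega), hvj, hvl, ?_⟩
        rw [hfe j hj, hfe l (by omega), ← hψl p]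
        exact hav (j + 1) (by omega) (by omega) (by omega)
      · refine ⟨e i, heT i (by omega), e j, heT j hj, hvi, hvj, ?_⟩
        rw [hfe i (by omega), hfe j hj]
        have hc := hcov (i + 1) (by omega)
        obtain rfl | rfl : j = i + 1 ∨ j = i + 2 := by omega
        · exact hc.ne_left
        · exact hc.ne_outer
    obtain ⟨i, hi, rfl⟩ := hmemC x hx
    obtain ⟨j, hj, rfl⟩ := hmemC y hy
    rcases lt_trichotomy i j with h | rfl | h
    · exact key i j h hj hvx hvy
    · exact absurd rfl hxy
    · exact key j i h hi hvy hvx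

theorem IsLargest.not_isAttached [Fintype V] (hG : IsCubic G) (hP : IsPartial G S f)
    (hS : IsLargest G S) (hk : 3 ≤ k) : ¬ IsAttached G S k e := by
  intro he
  obtain ⟨l, ⟨e', he'⟩, hmax⟩ := exists_isGreatest_nat (P := fun l => ∃ e, IsAttached G S l e)
    ⟨e, he⟩ fun l ⟨e', he'⟩ => he'.toIsPathOff.le_card
  exact hP.not_isLargest_of_longest_isAttached hG (hk.trans (hmax k ⟨e, he⟩)) he'
    (fun l' e'' h => hmax l' ⟨e'', h⟩) hS

end

/-! ### Adding a cycle -/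

section
variable {V : Type*} {G : SimpleGraph V} {S : Finset V} {f : V → Label} {k n : ℕ} {e : ℕ → V}

/-- A closed path avoiding `S` whose length admits a cyclic labelling. -/
structure IsGoodCycle (G : SimpleGraph V) (S : Finset V) (n : ℕ) (e : ℕ → V) : Prop
    extends IsPathOff G S n e where
  closed : G.Adj (e (n - 1)) (e 0)
  three_le : 3 ≤ n
  ne_four : n ≠ 4
  ne_seven : n ≠ 7

/-- A cycle avoiding `S`, parametrised periodically. -/
structure IsPeriodicCycle (G : SimpleGraph V) (S : Finset V) (n : ℕ) (e : ℕ → V) : Prop where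
  adj : ∀ i, G.Adj (e i) (e (i + 1))
  notMem : ∀ i, e i ∉ S
  periodic : ∀ i, e (i + n) = e i
  mod_eq : ∀ i j, e i = e j → i % n = j % n

theorem IsGoodCycle.isPeriodicCycle (h : IsGoodCycle G S n e) :
    IsPeriodicCycle G S n fun i => e (i % n) := by
  have hn := h.three_le
  have hlt : ∀ i, i % n < n := fun i => Nat.mod_lt _ (by omega)
  refine ⟨fun i => ?_, fun i => h.notMem _ (hlt i), fun i => by simp,
    fun i j => h.inj _ (hlt i) _ (hlt j)⟩
  have := hlt i
  rw [← Nat.mod_add_mod i n 1]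
  by_cases h' : i % n + 1 < n
  · rw [Nat.mod_eq_of_lt h']
    exact h.adj _ h'
  · rw [show i % n + 1 = n by omega, Nat.mod_self, show i % n = n - 1 by omega]
    exact h.closed

namespace IsPeriodicCycle

theorem map_mod (h : IsPeriodicCycle G S n e) (i : ℕ) : e (i % n) = e i :=
  Function.Periodic.map_mod_nat h.periodic i

theorem isPathOff (h : IsPeriodicCycle G S n e) (hk : k ≤ n) (a : ℕ) :
    IsPathOff G S k fun i => e (a + i) := by
  refine ⟨fun i _ => h.adj _, fun i _ => h.notMem _, fun i hi j hj hij => ?_⟩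
  have := Nat.ModEq.add_left_cancel' a (h.mod_eq _ _ hij)
  exact Nat.ModEq.eq_of_lt_of_lt this (by omega) (by omega)

/-- A vertex off the cycle with two neighbours on it closes a shorter cycle. -/
theorem eq_five (h : IsPeriodicCycle G S n e) (hmin : ∀ l e', IsGoodCycle G S l e' → n ≤ l)
    {v : V} (hv : v ∉ S) (hve : ∀ i, e i ≠ v) {a g : ℕ} (h3 : 3 ≤ g) (hg : g + 3 ≤ n)
    (hva : G.Adj v (e a)) (hvg : G.Adj v (e (a + g))) : g = 5 := by
  by_contra hg5
  have hpath := (h.isPathOff (k := g + 1) (by omega) a).snoc hv (fun i _ => hve _)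
    (by simpa using hvg.symm)
  have := hmin _ _ ⟨hpath, by simpa using hva, by omega, by omega, by omega⟩
  omega

/-- Two vertices off the cycle are not both attached to `S` and to the cycle. -/
theorem outer_unique (h : IsPeriodicCycle G S n e) (hn : 0 < n)
    (hatt : ∀ l e', 3 ≤ l → ¬ IsAttached G S l e') {v v' u u' : V} (hv : v ∉ S) (hv' : v' ∉ S)
    (hve : ∀ i, e i ≠ v) (hve' : ∀ i, e i ≠ v') (hu : u ∈ S) (hu' : u' ∈ S) (hvu : G.Adj v u)
    (hvu' : G.Adj v' u') {i j : ℕ} (hvi : G.Adj v (e i)) (hvj : G.Adj v' (e j)) : v = v' := by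
  by_contra hne
  obtain ⟨g, hg, hgj⟩ : ∃ g < n, e (i + g) = e j := by
    refine ⟨(j + n * i - i) % n, Nat.mod_lt _ hn, ?_⟩
    have hle : i ≤ j + n * i := le_add_left (Nat.le_mul_of_pos_left _ hn)
    rw [← h.map_mod, Nat.add_mod_mod, Nat.add_sub_cancel' hle, Nat.add_mul_mod_self_left,
      h.map_mod]
  have h1 := (h.isPathOff (k := g + 1) (by omega) i).reverse.snoc hv (fun i _ => hve _)
    (by simpa using hvi.symm)
  have h2 := h1.reverse.snoc hv' (fun l hl => ?_) (by simpa [hgj] using hvj.symm)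
  · exact hatt _ _ (by omega) ⟨h2, ⟨u, hu, by simpa using hvu⟩, u', hu', by simpa using hvu'⟩
  · split_ifs
    · exact hve' _
    · exact hne

end IsPeriodicCycle

theorem IsLargest.not_isGoodCycle [Fintype V] (hG : IsCubic G) (hP : IsPartial G S f)
    (hS : IsLargest G S) : ¬ IsGoodCycle G S k e := by
  classical
  intro hgood
  have hatt : ∀ l e', 3 ≤ l → ¬ IsAttached G S l e' := fun l e' hl => hS.not_isAttached hG hP hl
  have hex : ∃ n, ∃ e, IsGoodCycle G S n e := ⟨k, e, hgood⟩
  obtain ⟨n, ⟨e, he⟩, hmin⟩ : ∃ n, (∃ e, IsGoodCycle G S n e) ∧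
      ∀ l e', IsGoodCycle G S l e' → n ≤ l :=
    ⟨Nat.find hex, Nat.find_spec hex, fun l e' h => Nat.find_min' hex ⟨e', h⟩⟩
  have hn3 := he.three_le
  obtain ⟨p₀, hper₀, hcov₀, hten₀⟩ := exists_cycle_labelling hn3 he.ne_four he.ne_seven
  replace he := he.isPeriodicCycle
  generalize (fun i => e (i % n)) = e at he
  have hn : 0 < n := by omega
  set C := (Finset.range n).image e with hC
  have heC : ∀ i, e i ∈ C := fun i => by
    rw [← he.map_mod]
    exact Finset.mem_image_of_mem e (Finset.mem_range.mpr (Nat.mod_lt _ hn))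
  have heT : ∀ i, e i ∈ S ∪ C := fun i => Finset.mem_union_right _ (heC i)
  have hmemC : ∀ x ∈ C, ∃ i < n, e i = x := fun x hx => by simpa [hC] using hx
  obtain ⟨p, hper, hcov, hten, hatt'⟩ : ∃ p : ℕ → Label, (∀ i, p (i + n) = p i) ∧
      (∀ i, Cov (p i) (p (i + 1)) (p (i + 2))) ∧ (n = 10 → ∀ i, p i ≠ p (i + 5)) ∧
      ∀ v ∉ S ∪ C, ∀ u ∈ S, ∀ i, G.Adj v u → G.Adj v (e i) →
        ∃ u' ∈ S, ∃ j, G.Adj v u' ∧ G.Adj v (e j) ∧ p j ≠ f u' := by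
    by_cases hex : ∃ v ∉ S ∪ C, ∃ u ∈ S, ∃ i, G.Adj v u ∧ G.Adj v (e i)
    · obtain ⟨v, hv, u, hu, i, hvu, hvi⟩ := hex
      have huniq : ∀ v' ∉ S ∪ C, ∀ u' ∈ S, ∀ j, G.Adj v' u' → G.Adj v' (e j) → v = v' := by
        intro v' hv' u' hu' j hvu' hvj
        simp only [Finset.mem_union, not_or] at hv hv'
        exact he.outer_unique hn hatt hv.1 hv'.1 (fun l h => hv.2 (h ▸ heC l))
          (fun l h => hv'.2 (h ▸ heC l)) hu hu' hvu hvu' hvi hvj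
      by_cases hpi : p₀ i = f u
      · refine ⟨fun l => p₀ (l + 1), fun l => ?_, fun l => hcov₀ _, fun h l => hten₀ h _,
          fun v' hv' u' hu' j hvu' hvj => ?_⟩
        · dsimp only
          rw [add_right_comm, hper₀]
        · obtain rfl := huniq v' hv' u' hu' j hvu' hvj
          exact ⟨u, hu, i, hvu, hvi, hpi ▸ (hcov₀ i).ne_left.symm⟩
      · refine ⟨p₀, hper₀, hcov₀, hten₀, fun v' hv' u' hu' j hvu' hvj => ?_⟩
        obtain rfl := huniq v' hv' u' hu' j hvu' hvj
        exact ⟨u, hu, i, hvu, hvi, hpi⟩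
    · exact ⟨p₀, hper₀, hcov₀, hten₀, fun v hv u hu i hvu hvi =>
        absurd ⟨v, hv, u, hu, i, hvu, hvi⟩ hex⟩
  have hinj : Set.InjOn e (Set.Iio n) := fun i hi j hj h => by
    have := he.mod_eq i j h
    rwa [Nat.mod_eq_of_lt hi, Nat.mod_eq_of_lt hj] at this
  set f' : V → Label := fun x =>
    if x ∈ S then f x else p (Function.invFunOn e (Set.Iio n) x) with hf'
  have hfS : ∀ x ∈ S, f' x = f x := fun x hx => if_pos hx
  have hfe : ∀ i, f' (e i) = p i := fun i => by
    rw [← he.map_mod i, hf']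
    dsimp only
    rw [if_neg (he.notMem _), hinj.leftInvOn_invFunOn (Set.mem_Iio.mpr (Nat.mod_lt _ hn))]
    exact Function.Periodic.map_mod_nat hper i
  refine hS.not_isPartial_union (heC 0) (he.notMem 0) f' (hP.union hfS ?_ ?_ ?_)
  · intro v hv c
    obtain ⟨i, hi, rfl⟩ := hmemC v hv
    obtain ⟨j, hj⟩ : ∃ j, e (j + 1) = e i := ⟨i + n - 1, by
      rw [Nat.sub_add_cancel (by omega), he.periodic]⟩
    rw [← hj]
    rcases (hcov j).has c with h | h | h
    · exact ⟨e j, heT _, Or.inr (he.adj j).symm, hfe j ▸ h⟩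
    · exact ⟨e (j + 1), heT _, Or.inl rfl, hfe (j + 1) ▸ h⟩
    · exact ⟨e (j + 2), heT _, Or.inr (he.adj (j + 1)), hfe (j + 2) ▸ h⟩
  · intro v hv u hu x hx hvu hvx
    obtain ⟨i, hi, rfl⟩ := hmemC x hx
    obtain ⟨u', hu', j, hvu', hvj, hne⟩ := hatt' v hv u hu i hvu hvx
    exact ⟨e j, heT j, u', Finset.mem_union_left _ hu', hvj, hvu', by rwa [hfe, hfS u' hu']⟩
  · intro v hv hvS x hx y hy hvx hvy hxy
    have hvS : v ∉ S := fun h => hv (Finset.mem_union_left _ h)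
    have hve : ∀ i, e i ≠ v := fun i h => hv (h ▸ heT i)
    have key : ∀ i j, i < j → j < n → G.Adj v (e i) → G.Adj v (e j) → p i ≠ p j := by
      intro i j hij hj hvi hvj
      obtain ⟨g, rfl⟩ := Nat.exists_eq_add_of_lt hij
      by_cases h1 : g = 0
      · subst h1
        exact (hcov i).ne_left
      by_cases h2 : g = 1
      · subst h2
        exact (hcov i).ne_outer
      by_cases h3 : n = g + 2
      · subst h3
        rw [← hper i]
        exact (hcov (i + g + 1)).ne_left.symm
      by_cases h4 : n = g + 3
      · subst h4
        rw [← hper i]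
        exact (hcov (i + g + 1)).ne_outer.symm
      have hg5 := he.eq_five hmin hvS hve (g := g + 1) (by omega) (by omega) hvi hvj
      have hn5 := he.eq_five hmin hvS hve (a := i + g + 1) (g := n - (g + 1)) (by omega)
        (by omega) hvj (by
          rw [show i + g + 1 + (n - (g + 1)) = i + n by omega, he.periodic]
          exact hvi)
      obtain rfl : g = 4 := by omega
      exact hten (by omega) i
    obtain ⟨i, hi, rfl⟩ := hmemC x hx
    obtain ⟨j, hj, rfl⟩ := hmemC y hy
    refine ⟨e i, heT i, e j, heT j, hvx, hvy, ?_⟩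
    rw [hfe, hfe]
    rcases lt_trichotomy i j with h | rfl | h
    · exact key i j h hj hvx hvy
    · exact absurd rfl hxy
    · exact (key j i h hi hvy hvx).symm

end

/-! ### Completing a largest partial configuration -/

section
variable {V : Type*} {G : SimpleGraph V} {S : Finset V} {f : V → Label} {k : ℕ} {e : ℕ → V}

theorem IsPathOff.exists_adj_last (hG : IsCubic G)
    (hcyc : ∀ l e', ¬ IsGoodCycle G S l e') (hk : 3 ≤ k) (he : IsPathOff G S k e)
    (hmax : ∀ l e', IsPathOff G S l e' → l ≤ k) : ∃ u ∈ S, G.Adj (e (k - 1)) u := by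
  by_contra! hS
  obtain ⟨x, y, hx, hy, hxy, hxe, hye⟩ := hG.exists_adj_ne (e (k - 1)) (e (k - 2))
  have hmem : ∀ z, G.Adj (e (k - 1)) z → z ≠ e (k - 2) → ∃ i, i + 2 < k ∧ e i = z := by
    intro z hz hze
    by_contra! hne
    have hzS : z ∉ S := fun h => hS z h hz
    have := hmax _ _ (he.snoc hzS (fun i hi => ?_) hz)
    · omega
    · rintro rfl
      rcases lt_trichotomy (i + 2) k with h | h | h
      · exact hne i h rfl
      · exact hze (by rw [← h]; rfl)
      · exact hz.ne (by rw [show i = k - 1 by omega])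
  have key : ∀ i j, i < j → j + 2 < k → G.Adj (e (k - 1)) (e i) → G.Adj (e (k - 1)) (e j) →
      False := by
    intro i j hij hj hi' hj'
    have hclosed : ∀ a, a + 2 < k → G.Adj (e (k - 1)) (e a) → k - a = 4 ∨ k - a = 7 := by
      intro a ha hadj
      by_contra! hne
      refine hcyc _ _ ⟨he.drop a, ?_, by omega, hne.1, hne.2⟩
      rwa [show a + (k - a - 1) = k - 1 by omega]
    have h1 := hclosed i (by omega) hi'
    have h2 := hclosed j (by omega) hj'
    have hlast : ∀ l, l < j + 1 - i → e (i + l) ≠ e (k - 1) := fun l hl h => by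
      have := he.inj _ (by omega) _ (by omega) h
      omega
    refine hcyc _ _ ⟨((he.take (l := j + 1) (by omega)).drop i).snoc
      (he.notMem (k - 1) (by omega)) hlast ?_, ?_, by omega, by omega, by omega⟩
    · rw [show i + (j + 1 - i - 1) = j by omega]
      exact hj'.symm
    · have hpos : 0 < j + 1 - i := by omega
      simpa [hpos] using hi'
  obtain ⟨i, hi, rfl⟩ := hmem x hx hxe
  obtain ⟨j, hj, rfl⟩ := hmem y hy hye
  rcases lt_trichotomy i j with h | rfl | h
  · exact key i j h hj hx hy
  · exact hxy rfl
  · exact key j i h hi hy hx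

theorem IsLargest.not_isPathOff [Fintype V] (hG : IsCubic G) (hP : IsPartial G S f)
    (hS : IsLargest G S) (hk : 3 ≤ k) : ¬ IsPathOff G S k e := by
  intro he
  obtain ⟨l, ⟨e', he'⟩, hmax⟩ := exists_isGreatest_nat (P := fun l => ∃ e, IsPathOff G S l e)
    ⟨e, he⟩ fun l ⟨e', he'⟩ => he'.le_card
  have hl : 3 ≤ l := hk.trans (hmax k ⟨e, he⟩)
  have hlast : ∀ e', IsPathOff G S l e' → ∃ u ∈ S, G.Adj (e' (l - 1)) u := fun e' he' =>
    he'.exists_adj_last hG (fun _ _ => hS.not_isGoodCycle hG hP) hl fun l' e'' h =>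
      hmax l' ⟨e'', h⟩
  exact hS.not_isAttached hG hP hl ⟨he', by simpa using hlast _ he'.reverse, hlast _ he'⟩

theorem IsLargest.eq_of_adj [Fintype V] (hG : IsCubic G) (hP : IsPartial G S f)
    (hS : IsLargest G S) {v x y : V} (hv : v ∉ S) (hx : x ∉ S) (hy : y ∉ S) (hvx : G.Adj v x)
    (hvy : G.Adj v y) : x = y := by
  by_contra hxy
  refine hS.not_isPathOff hG hP (k := 3)
    (e := fun i => if i = 0 then x else if i = 1 then v else y) le_rfl
    ⟨fun i hi => ?_, fun i hi => ?_, fun i hi j hj hij => ?_⟩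
  · obtain rfl | rfl : i = 0 ∨ i = 1 := by omega
    · simpa using hvx.symm
    · simpa using hvy
  · split_ifs <;> assumption
  · have := hvx.ne
    have := hvy.ne
    grind

theorem IsLargest.exists_cov [Fintype V] (hG : IsCubic G) (hP : IsPartial G S f)
    (hS : IsLargest G S) {v : V} (hv : v ∉ S) :
    ∃ x ∈ S, ∃ y ∈ S, G.Adj v x ∧ G.Adj v y ∧ ∃ c, Cov (f x) (f y) c := by
  obtain ⟨a, b, c, hab, hac, hbc, h⟩ := hG v
  have ha : G.Adj v a := by simp [h]
  have hb : G.Adj v b := by simp [h]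
  have hc : G.Adj v c := by simp [h]
  have hle : ∀ x y, G.Adj v x → G.Adj v y → x ≠ y → x ∈ S ∨ y ∈ S := by
    intro x y hx hy hxy
    by_contra! h
    exact hxy (hS.eq_of_adj hG hP hv h.1 h.2 hx hy)
  obtain ⟨x, hx, y, hy, hvx, hvy, hxy⟩ : ∃ x ∈ S, ∃ y ∈ S, G.Adj v x ∧ G.Adj v y ∧ x ≠ y := by
    by_cases haS : a ∈ S
    · rcases hle b c hb hc hbc with h | h
      · exact ⟨a, haS, b, h, ha, hb, hab⟩
      · exact ⟨a, haS, c, h, ha, hc, hac⟩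
    · exact ⟨b, (hle a b ha hb hab).resolve_left haS, c, (hle a c ha hc hac).resolve_left haS,
        hb, hc, hbc⟩
  obtain ⟨x', hx', y', hy', hvx', hvy', hne⟩ := hP.sep v hv x hx y hy hvx hvy hxy
  exact ⟨x', hx', y', hy', hvx', hvy', exists_cov_of_ne hne⟩

theorem exists_isPartial_isLargest [Fintype V] (G : SimpleGraph V) :
    ∃ S f, IsPartial G S f ∧ IsLargest G S := by
  obtain ⟨n, ⟨S, f, hP, rfl⟩, hmax⟩ := exists_isGreatest_nat
    (P := fun n => ∃ S f, IsPartial G S f ∧ S.card = n) (a := 0) (N := Fintype.card V)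
    ⟨∅, fun _ => 0, ⟨by simp, by simp⟩, rfl⟩
    (by rintro _ ⟨S, f, -, rfl⟩; exact S.card_le_univ)
  exact ⟨S, f, hP, fun S' f' h => hmax _ ⟨S', f', h, rfl⟩⟩

/-! ### Configurations -/

theorem config_five_two [Fintype V] (hG : IsCubic G) : Config G 5 2 := by
  classical
  obtain ⟨S, f, hP, hS⟩ := exists_isPartial_isLargest G
  choose! x hx y hy hvx hvy g hg using fun v (hv : v ∉ S) => hS.exists_cov hG hP hv
  refine ⟨fun v => toFinset (if v ∈ S then f v else g v), fun v => card_toFinset _, fun c v => ?_⟩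
  simp only [toFinset, Finset.mem_filter, Finset.mem_univ, true_and]
  by_cases hv : v ∈ S
  · obtain ⟨u, hu, rfl | hvu, hc⟩ := hP.cover v hv c
    · exact Or.inl (by rwa [if_pos hu])
    · exact Or.inr ⟨u, hvu, by rwa [if_pos hu]⟩
  · rcases (hg v hv).has c with h | h | h
    · exact Or.inr ⟨x v, hvx v hv, by rwa [if_pos (hx v hv)]⟩
    · exact Or.inr ⟨y v, hvy v hv, by rwa [if_pos (hy v hv)]⟩
    · exact Or.inl (by rwa [if_neg hv])

theorem config_two_one [Finite V] (h : ∀ v, ∃ u, G.Adj v u) : Config G 2 1 := by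
  classical
  obtain ⟨I, hI⟩ := (Set.toFinite {I : Set V | G.IsIndepSet I}).exists_maximal
    ⟨∅, by simp [SimpleGraph.IsIndepSet]⟩
  have hdom : ∀ v ∉ I, ∃ u ∈ I, G.Adj v u := by
    intro v hv
    by_contra! hne
    refine hv (hI.2 (y := insert v I) ?_ (Set.subset_insert v I) (Set.mem_insert v I))
    refine hI.1.insert fun u hu _ => ⟨hne u hu, fun h => hne u hu h.symm⟩
  refine ⟨fun v => {if v ∈ I then 0 else 1}, fun v => Finset.card_singleton _, fun i v => ?_⟩
  simp only [Finset.mem_singleton]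
  by_cases hv : v ∈ I
  · obtain ⟨u, hvu⟩ := h v
    have hu : u ∉ I := fun hu => hI.1 hv hu hvu.ne hvu
    fin_cases i
    · exact Or.inl (by simp [hv])
    · exact Or.inr ⟨u, hvu, by simp [hu]⟩
  · obtain ⟨u, hu, hvu⟩ := hdom v hv
    fin_cases i
    · exact Or.inr ⟨u, hvu, by simp [hu]⟩
    · exact Or.inl (by simp [hv])

theorem config_zero (G : SimpleGraph V) : Config G 0 0 :=
  ⟨fun _ => ∅, fun _ => rfl, fun i => i.elim0⟩

theorem config_add {a b s t : ℕ} (h₁ : Config G a s) (h₂ : Config G b t) :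
    Config G (a + b) (s + t) := by
  obtain ⟨f, hf, hf'⟩ := h₁
  obtain ⟨g, hg, hg'⟩ := h₂
  refine ⟨fun v => ((f v).disjSum (g v)).map finSumFinEquiv.toEmbedding, fun v => ?_,
    fun i v => ?_⟩
  · rw [Finset.card_map, Finset.card_disjSum, hf, hg]
  · obtain ⟨i, rfl⟩ := finSumFinEquiv.surjective i
    simp only [Finset.mem_map_equiv, Equiv.symm_apply_apply]
    rcases i with i | i
    · simpa using hf' i v
    · simpa using hg' i v

theorem config_even (h : Config G 5 2) (s : ℕ) : Config G (5 * s) (2 * s) := by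
  induction s with
  | zero => exact config_zero G
  | succ s ih => exact config_add ih h

end

end CubicConfig

/-- every finite cubic graph has a `(⌊5σ/2⌋, σ)`-configuration for
every positive integer `σ`. -/
theorem cubic_config
    {V : Type*} [Fintype V] [DecidableEq V] (G : SimpleGraph V) [DecidableRel G.Adj]
    (hcubic : ∀ v : V, G.degree v = 3) :
    ∀ σ : ℕ, 0 < σ → Config G (5 * σ / 2) σ := by
  intro σ _
  have hG := CubicConfig.isCubic_of_degree hcubic
  have h52 := CubicConfig.config_five_two hG
  obtain ⟨s, rfl | rfl⟩ := Nat.even_or_odd' σ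
  · rw [show 5 * (2 * s) / 2 = 5 * s by omega]
    exact CubicConfig.config_even h52 s
  · rw [show 5 * (2 * s + 1) / 2 = 5 * s + 2 by omega]
    refine CubicConfig.config_add (CubicConfig.config_even h52 s)
      (CubicConfig.config_two_one fun v => ?_)
    obtain ⟨x, -, hx, -⟩ := hG.exists_adj_ne v v
    exact ⟨x, hx⟩
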